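/- arXiv:1204.2586 — 9 statements merged into one kernel-verified Lean document; each statement's English description precedes it below -/
import Mathlib

section
/- For every f ∈ ℝ^{n_h} and every pair (x̄, x̂) ∈ ℝ^{n_H} × ℝ^{n_h}, the augmented equation 𝒜 (x̄, x̂) = (R f, f) holds if and only if A (P x̄ + x̂) = f. (In other words, the original linear system A u = f is equivalent to the augmented matrix system arising from the redundant representation u = P x̄ + x̂.) -/
open Matrix

/-- The augmented system `𝒜 (x̄, x̂) = (R f, f)` (with
`𝒜 = [[RAP, RA], [AP, A]]`, `R = Pᵀ`) holds iff `A (P x̄ + x̂) = f`. -/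
theorem augmented_system_equiv (nH nh : ℕ) (hnH : 0 < nH) (hnh : 0 < nh)
    (A : Matrix (Fin nh) (Fin nh) ℝ) (hA : A.PosDef)
    (P : Matrix (Fin nh) (Fin nH) ℝ)
    (f : Fin nh → ℝ) (xbar : Fin nH → ℝ) (xhat : Fin nh → ℝ) :
    (Matrix.fromBlocks (Pᵀ * A * P) (Pᵀ * A) (A * P) A).mulVec (Sum.elim xbar xhat)
        = Sum.elim (Pᵀ.mulVec f) f
      ↔ A.mulVec (P.mulVec xbar + xhat) = f := by
  have hfine : (A * P) *ᵥ xbar + A *ᵥ xhat = A *ᵥ (P *ᵥ xbar + xhat) := by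
    rw [mulVec_add, mulVec_mulVec]
  have hcoarse : (Pᵀ * A * P) *ᵥ xbar + (Pᵀ * A) *ᵥ xhat
      = Pᵀ *ᵥ (A *ᵥ (P *ᵥ xbar + xhat)) := by
    simp only [mulVec_add, mulVec_mulVec, Matrix.mul_assoc]
  rw [fromBlocks_mulVec, Sum.elim_comp_inl, Sum.elim_comp_inr, hfine, hcoarse, Sum.elim_eq_iff]
  exact ⟨And.right, fun h => ⟨congrArg _ h, h⟩⟩
end

section
/- A vector x = (x̄, x̂) ∈ ℝ^{n_H + n_h} satisfies 𝒜 x = 0 if and only if x̂ = −P x̄; that is, the null space of 𝒜 is exactly 𝒩(𝒜) = { (c, −P c) : c ∈ ℝ^{n_H} }. -/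
open Matrix

theorem fromBlocks_galerkin_mulVec {R m n : Type*} [CommRing R] [Fintype m] [Fintype n]
    (A : Matrix n n R) (P : Matrix n m R) (x : m → R) (y : n → R) :
    (fromBlocks (Pᵀ * A * P) (Pᵀ * A) (A * P) A) *ᵥ Sum.elim x y =
      Sum.elim (Pᵀ *ᵥ A *ᵥ (P *ᵥ x + y)) (A *ᵥ (P *ᵥ x + y)) := by
  simp [fromBlocks_mulVec, mulVec_add, mulVec_mulVec, Matrix.mul_assoc]

/-- `𝒜 (x̄, x̂) = 0` iff `x̂ = -P x̄`, i.e. the null space of the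
augmented matrix `𝒜` is exactly `{ (c, -P c) : c ∈ ℝ^{n_H} }`. -/
theorem augmented_kernel (nH nh : ℕ) (hnH : 0 < nH) (hnh : 0 < nh)
    (A : Matrix (Fin nh) (Fin nh) ℝ) (hA : A.PosDef)
    (P : Matrix (Fin nh) (Fin nH) ℝ)
    (xbar : Fin nH → ℝ) (xhat : Fin nh → ℝ) :
    (Matrix.fromBlocks (Pᵀ * A * P) (Pᵀ * A) (A * P) A).mulVec (Sum.elim xbar xhat) = 0
      ↔ xhat = -(P.mulVec xbar) := by
  have hinj : Function.Injective A.mulVec := mulVec_injective_of_isUnit hA.isUnit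
  rw [fromBlocks_galerkin_mulVec, eq_neg_iff_add_eq_zero, add_comm xhat]
  constructor
  · intro h
    apply hinj
    rw [mulVec_zero]
    exact funext fun i => congrFun h (Sum.inr i)
  · intro h
    simp [h]
end

section
/- A vector y = (ȳ, ŷ) ∈ ℝ^{n_H + n_h} lies in the range of 𝒜 (i.e., y = 𝒜 x for some x) if and only if ȳ = R ŷ; that is, the range of 𝒜 is exactly ℛ(𝒜) = { (R v, v) : v ∈ ℝ^{n_h} }. -/
open Matrix

/-- The augmented matrix maps `(x̄, x̂)` to `(R v, v)` with `v = A (P x̄ + x̂)`. -/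
theorem augmented_mulVec {m n S : Type*} [Fintype m] [Fintype n] [CommRing S]
    (A : Matrix n n S) (P : Matrix n m S) (R : Matrix m n S) (x : m ⊕ n → S) :
    (Matrix.fromBlocks (R * A * P) (R * A) (A * P) A).mulVec x =
      Sum.elim (R.mulVec (A.mulVec (P.mulVec (x ∘ Sum.inl) + x ∘ Sum.inr)))
        (A.mulVec (P.mulVec (x ∘ Sum.inl) + x ∘ Sum.inr)) := by
  simp [Matrix.fromBlocks_mulVec, Matrix.mulVec_add, Matrix.mulVec_mulVec, Matrix.mul_assoc]

/-- `(ȳ, ŷ)` lies in the range of the augmented matrix `𝒜` iff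
`ȳ = R ŷ` (with `R = Pᵀ`), i.e. the range of `𝒜` is `{ (R v, v) : v ∈ ℝ^{n_h} }`. -/
theorem augmented_range (nH nh : ℕ) (hnH : 0 < nH) (hnh : 0 < nh)
    (A : Matrix (Fin nh) (Fin nh) ℝ) (hA : A.PosDef)
    (P : Matrix (Fin nh) (Fin nH) ℝ)
    (ybar : Fin nH → ℝ) (yhat : Fin nh → ℝ) :
    (∃ x : Fin nH ⊕ Fin nh → ℝ,
        (Matrix.fromBlocks (Pᵀ * A * P) (Pᵀ * A) (A * P) A).mulVec x = Sum.elim ybar yhat)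
      ↔ ybar = Pᵀ.mulVec yhat := by
  simp only [augmented_mulVec, Sum.elim_eq_iff]
  constructor
  · rintro ⟨x, rfl, rfl⟩
    rfl
  · rintro rfl
    obtain ⟨v, rfl⟩ := (Matrix.mulVec_surjective_iff_isUnit.2 hA.isUnit) yhat
    exact ⟨Sum.elim 0 v, by simp⟩
end

section
/- The augmented matrix 𝒜 is symmetric and positive semidefinite; if n_H ≥ 1 then 𝒜 is singular (its kernel is nontrivial); and if moreover every column of P is nonzero, then every diagonal entry of 𝒜 is positive. -/
open Matrix

namespace Matrix

variable {m n R : Type*} [Fintype n] [CommRing R]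

/-- The augmented matrix is the congruence of `A` by the block row `[P, 1]`. -/
lemma fromBlocks_eq_transpose_fromCols_mul_mul [DecidableEq n]
    (A : Matrix n n R) (P : Matrix n m R) :
    fromBlocks (Pᵀ * A * P) (Pᵀ * A) (A * P) A =
      (fromCols P 1)ᵀ * A * fromCols P (1 : Matrix n n R) := by
  simp [transpose_fromCols, fromRows_mul]

/-- The vectors `(x, -P x)` lie in the kernel of the augmented matrix. -/
lemma fromBlocks_mulVec_elim_neg_mulVec [Fintype m]
    (A : Matrix n n R) (P : Matrix n m R) (x : m → R) :
    fromBlocks (Pᵀ * A * P) (Pᵀ * A) (A * P) A *ᵥ Sum.elim x (-(P *ᵥ x)) = 0 := by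
  ext (i | i) <;> simp [fromBlocks_mulVec, mulVec_neg, mulVec_mulVec]

/-- A congruence `Pᵀ A P` of a positive definite matrix has a positive diagonal entry at every
nonzero column of `P`. -/
lemma PosDef.transpose_mul_mul_apply_pos {A : Matrix n n ℝ} (hA : A.PosDef)
    (P : Matrix n m ℝ) {j : m} (hj : P.col j ≠ 0) : 0 < (Pᵀ * A * P) j j := by
  have h := hA.dotProduct_mulVec_pos hj
  rwa [star_trivial, dotProduct_mulVec] at h

end Matrix

/-- The augmented matrix `𝒜` is symmetric and positive semidefinite;
it is singular (nontrivial kernel, as `n_H ≥ 1`); and if every column of `P` is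
nonzero then every diagonal entry of `𝒜` is positive. -/
theorem augmented_symm_psd_singular (nH nh : ℕ) (hnH : 0 < nH) (hnh : 0 < nh)
    (A : Matrix (Fin nh) (Fin nh) ℝ) (hA : A.PosDef)
    (P : Matrix (Fin nh) (Fin nH) ℝ) :
    (Matrix.fromBlocks (Pᵀ * A * P) (Pᵀ * A) (A * P) A).IsSymm
      ∧ (Matrix.fromBlocks (Pᵀ * A * P) (Pᵀ * A) (A * P) A).PosSemidef
      ∧ (∃ x : Fin nH ⊕ Fin nh → ℝ, x ≠ 0 ∧
          (Matrix.fromBlocks (Pᵀ * A * P) (Pᵀ * A) (A * P) A).mulVec x = 0)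
      ∧ ((∀ j : Fin nH, (fun i => P i j) ≠ 0) →
          ∀ k : Fin nH ⊕ Fin nh,
            0 < Matrix.fromBlocks (Pᵀ * A * P) (Pᵀ * A) (A * P) A k k) := by
  have hpsd : (fromBlocks (Pᵀ * A * P) (Pᵀ * A) (A * P) A).PosSemidef := by
    rw [fromBlocks_eq_transpose_fromCols_mul_mul, ← conjTranspose_eq_transpose_of_trivial]
    exact hA.posSemidef.conjTranspose_mul_mul_same _
  refine ⟨?_, ?_, ?_, ?_⟩
  · exact isHermitian_iff_isSymm.mp hpsd.isHermitian
  · exact hpsd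
  · refine ⟨_, fun h => ?_, fromBlocks_mulVec_elim_neg_mulVec A P fun _ => 1⟩
    simpa using congrFun h (Sum.inl ⟨0, hnH⟩)
  · rintro hP (j | i)
    · exact hA.transpose_mul_mul_apply_pos P (hP j)
    · exact hA.diag_pos
end

section
/- (i) 𝒜 + L D⁻¹ Lᵀ = (D − L) D⁻¹ (D − L)ᵀ; consequently, if D is in addition positive definite, then 𝒜 + S is symmetric positive definite (in particular invertible). (ii) With B := (D − L)⁻¹ one has the matrix identity (I − Bᵀ 𝒜)(I − B 𝒜) = I − (𝒜 + S)⁻¹ 𝒜, where S := L D⁻¹ Lᵀ. -/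
open Matrix

/-- With `𝒜 = D - L - Lᵀ`, `S = L D⁻¹ Lᵀ`, `B = (D - L)⁻¹`:
(i) `𝒜 + S = (D - L) D⁻¹ (D - L)ᵀ`, hence if `D` is positive definite then
`𝒜 + S` is symmetric positive definite; (ii) `(I - Bᵀ 𝒜)(I - B 𝒜) = I - (𝒜 + S)⁻¹ 𝒜`. -/
theorem symmetrized_splitting (n : ℕ) (hn : 0 < n)
    (D L : Matrix (Fin n) (Fin n) ℝ)
    (hDsymm : D.IsSymm) (hDinv : IsUnit D) (hDL : IsUnit (D - L)) :
    (D - L - Lᵀ) + L * D⁻¹ * Lᵀ = (D - L) * D⁻¹ * (D - L)ᵀ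
      ∧ (D.PosDef → ((D - L - Lᵀ) + L * D⁻¹ * Lᵀ).PosDef)
      ∧ (1 - ((D - L)⁻¹)ᵀ * (D - L - Lᵀ)) * (1 - (D - L)⁻¹ * (D - L - Lᵀ))
          = 1 - ((D - L - Lᵀ) + L * D⁻¹ * Lᵀ)⁻¹ * (D - L - Lᵀ) := by
  have hMt : (D - L)ᵀ = D - Lᵀ := by rw [transpose_sub, hDsymm.eq]
  have hDdet : IsUnit D.det := (isUnit_iff_isUnit_det D).mp hDinv
  have hMdet : IsUnit (D - L).det := (isUnit_iff_isUnit_det _).mp hDL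
  have hfactor : (D - L - Lᵀ) + L * D⁻¹ * Lᵀ = (D - L) * D⁻¹ * (D - L)ᵀ := by
    rw [hMt, sub_mul, mul_nonsing_inv D hDdet, sub_mul, one_mul, mul_sub,
      nonsing_inv_mul_cancel_right D L hDdet]
    abel
  refine ⟨hfactor, fun hD => ?_, ?_⟩
  · rw [hfactor, ← conjTranspose_eq_transpose_of_trivial]
    exact hD.inv.mul_mul_conjTranspose_same (vecMul_injective_of_isUnit hDL)
  · rw [hfactor, Matrix.mul_inv_rev, Matrix.mul_inv_rev, nonsing_inv_nonsing_inv D hDdet,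
      ← transpose_nonsing_inv]
    have hA : D - L - Lᵀ = (D - L) + (D - L)ᵀ - D := by rw [hMt]; abel
    rw [hA]
    have hMtB : ((D - L)⁻¹)ᵀ * (D - L)ᵀ = 1 := by
      rw [← transpose_mul, mul_nonsing_inv _ hMdet, transpose_one]
    have hMB : (D - L) * (D - L)⁻¹ = 1 := mul_nonsing_inv _ hMdet
    generalize (D - L)ᵀ = N at *
    generalize ((D - L)⁻¹)ᵀ = C at *
    generalize (D - L)⁻¹ = B at *
    generalize D - L = M at *
    have hC : C * (M + N - D) * B = C + B - C * D * B := by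
      rw [mul_sub, mul_add, hMtB, sub_mul, add_mul, mul_assoc C M B, hMB, mul_one, one_mul]
    calc (1 - C * (M + N - D)) * (1 - B * (M + N - D))
        = 1 - (C + B - C * (M + N - D) * B) * (M + N - D) := by noncomm_ring
      _ = 1 - C * (D * B) * (M + N - D) := by rw [hC, sub_sub_cancel, mul_assoc C D B]
end

section
/- (Convergence Rate Identity.) Assume 𝒜 ≠ 0. Define K := 1 + sup_{u ∈ N⊥, u ≠ 0} inf_{c ∈ N} ⟨S(u + c), u + c⟩ / ⟨𝒜 u, u⟩ (the supremum of this set of real numbers exists, the set being nonempty and bounded above). Then the squared 𝒜-seminorm of the error propagation matrix satisfies sup_{u ∈ N⊥, u ≠ 0} ⟨𝒜 E u, E u⟩ / ⟨𝒜 u, u⟩ = 1 − 1/K. -/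
open Matrix

section Auxiliary

variable {n : ℕ}

lemma sSup_eq_one_sub_inv_one_add_sSup {X Y : Set ℝ} (hX : X.Nonempty) (hbdd : BddAbove X)
    (hX0 : ∀ x ∈ X, 0 ≤ x)
    (hY : ∀ y ∈ Y, y < 1 ∧ ∃ x ∈ X, y ≤ 1 - 1 / (1 + x))
    (hXY : ∀ x ∈ X, ∃ y ∈ Y, 1 + x ≤ 1 / (1 - y)) :
    sSup Y = 1 - 1 / (1 + sSup X) := by
  obtain ⟨x₀, hx₀⟩ := hX
  have hk : 0 ≤ sSup X := (hX0 x₀ hx₀).trans (le_csSup hbdd hx₀)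
  have hub : ∀ y ∈ Y, y ≤ 1 - 1 / (1 + sSup X) := by
    intro y hy
    obtain ⟨-, x, hx, hyx⟩ := hY y hy
    have hx0 := hX0 x hx
    have hxs := le_csSup hbdd hx
    have : 1 / (1 + sSup X) ≤ 1 / (1 + x) := by gcongr
    linarith
  obtain ⟨y₀, hy₀, -⟩ := hXY x₀ hx₀
  have hYb : BddAbove Y := ⟨_, hub⟩
  have hle : sSup Y ≤ 1 - 1 / (1 + sSup X) := csSup_le ⟨y₀, hy₀⟩ hub
  have hpos : 0 < 1 / (1 + sSup X) := by positivity
  have hσ : 0 < 1 - sSup Y := by linarith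
  have hK : 1 + sSup X ≤ 1 / (1 - sSup Y) := by
    have : sSup X ≤ 1 / (1 - sSup Y) - 1 := by
      refine csSup_le ⟨x₀, hx₀⟩ fun x hx => ?_
      obtain ⟨y, hy, hxy⟩ := hXY x hx
      have hys := le_csSup hYb hy
      have : 1 / (1 - y) ≤ 1 / (1 - sSup Y) := by gcongr
      linarith
    linarith
  have : 1 - sSup Y ≤ 1 / (1 + sSup X) := by
    rw [le_div_iff₀ (by linarith)]
    rw [le_div_iff₀ hσ] at hK
    linarith
  linarith

lemma Matrix.IsSymm.mulVec_dotProduct {A : Matrix (Fin n) (Fin n) ℝ} (hA : A.IsSymm)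
    (x y : Fin n → ℝ) : A *ᵥ x ⬝ᵥ y = x ⬝ᵥ A *ᵥ y := by
  rw [dotProduct_mulVec, ← mulVec_transpose, hA.eq]

lemma Matrix.PosSemidef.isSymm_real {A : Matrix (Fin n) (Fin n) ℝ} (hA : A.PosSemidef) :
    A.IsSymm := by
  have := hA.isHermitian
  rwa [Matrix.IsHermitian, conjTranspose_eq_transpose_of_trivial] at this

lemma Matrix.PosSemidef.zero_le_mulVec_dotProduct {A : Matrix (Fin n) (Fin n) ℝ}
    (hA : A.PosSemidef) (x : Fin n → ℝ) : 0 ≤ A *ᵥ x ⬝ᵥ x := by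
  simpa [dotProduct_comm] using hA.dotProduct_mulVec_nonneg x

lemma Matrix.PosSemidef.sq_mulVec_dotProduct_le {A : Matrix (Fin n) (Fin n) ℝ}
    (hA : A.PosSemidef) (x y : Fin n → ℝ) :
    (A *ᵥ x ⬝ᵥ y) ^ 2 ≤ (A *ᵥ x ⬝ᵥ x) * (A *ᵥ y ⬝ᵥ y) := by
  have h : ∀ t : ℝ, 0 ≤ (A *ᵥ x ⬝ᵥ x) * (t * t) + (2 * (A *ᵥ x ⬝ᵥ y)) * t + A *ᵥ y ⬝ᵥ y := by
    intro t
    have h0 := hA.zero_le_mulVec_dotProduct (t • x + y)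
    have hs : A *ᵥ y ⬝ᵥ x = A *ᵥ x ⬝ᵥ y := by
      rw [hA.isSymm_real.mulVec_dotProduct, dotProduct_comm]
    simp only [mulVec_add, mulVec_smul, add_dotProduct, dotProduct_add, smul_dotProduct,
      dotProduct_smul, smul_eq_mul, hs] at h0
    linarith
  have := discrim_le_zero h
  rw [discrim] at this
  linarith

/-- If `A` is symmetric and `R` is positive definite, `A R A` has the same range as `A`. -/
lemma Matrix.PosDef.exists_conj_mulVec_eq {A R : Matrix (Fin n) (Fin n) ℝ} (hA : A.IsSymm)
    (hR : R.PosDef) (u : Fin n → ℝ) : ∃ w, A *ᵥ (R *ᵥ (A *ᵥ w)) = A *ᵥ u := by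
  set f := (A * R * A).mulVecLin
  set g := A.mulVecLin
  have hfx : ∀ x, f x = A *ᵥ (R *ᵥ (A *ᵥ x)) := fun x => by
    simp [f, mulVec_mulVec]
  have hker : LinearMap.ker f = LinearMap.ker g := by
    ext x
    rw [LinearMap.mem_ker, LinearMap.mem_ker, hfx]
    change _ ↔ A *ᵥ x = 0
    refine ⟨fun h => ?_, fun h => by simp [h]⟩
    by_contra hne
    have h1 := hR.dotProduct_mulVec_pos hne
    rw [star_trivial, hA.mulVec_dotProduct, h, dotProduct_zero] at h1
    exact lt_irrefl _ h1
  have hle : LinearMap.range f ≤ LinearMap.range g := by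
    rintro _ ⟨x, rfl⟩
    exact ⟨R *ᵥ (A *ᵥ x), (hfx x).symm⟩
  have h1 := f.finrank_range_add_finrank_ker
  have h2 := g.finrank_range_add_finrank_ker
  rw [hker] at h1
  have heq := Submodule.eq_of_le_of_finrank_eq hle (by omega)
  have hu : g u ∈ LinearMap.range f := heq ▸ ⟨u, rfl⟩
  obtain ⟨w, hw⟩ := hu
  exact ⟨w, (hfx w).symm.trans hw⟩

lemma Matrix.PosSemidef.mulVec_dotProduct_pos_of_orthogonal_ker {A : Matrix (Fin n) (Fin n) ℝ}
    (hA : A.PosSemidef) {u : Fin n → ℝ} (hu : ∀ c, A *ᵥ c = 0 → u ⬝ᵥ c = 0) (hu0 : u ≠ 0) :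
    0 < A *ᵥ u ⬝ᵥ u := by
  refine lt_of_le_of_ne (hA.zero_le_mulVec_dotProduct u) fun h => hu0 ?_
  refine dotProduct_self_eq_zero.1 (hu u ((hA.dotProduct_mulVec_zero_iff u).1 ?_))
  rw [star_trivial, dotProduct_comm, ← h]

/-- Any quadratic form is bounded by a multiple of a positive semidefinite one on the orthogonal
complement of the kernel of the latter. -/
lemma Matrix.PosSemidef.exists_div_le_of_orthogonal_ker {A : Matrix (Fin n) (Fin n) ℝ}
    (hA : A.PosSemidef) (S : Matrix (Fin n) (Fin n) ℝ) :
    ∃ C : ℝ, ∀ u : Fin n → ℝ, (∀ c, A *ᵥ c = 0 → u ⬝ᵥ c = 0) → u ≠ 0 →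
      (S *ᵥ u ⬝ᵥ u) / (A *ᵥ u ⬝ᵥ u) ≤ C := by
  have hcont : ∀ M : Matrix (Fin n) (Fin n) ℝ,
      Continuous fun u : Fin n → ℝ => M *ᵥ u ⬝ᵥ u := fun M =>
    (Continuous.matrix_mulVec continuous_const continuous_id).dotProduct continuous_id
  set Q : Set (Fin n → ℝ) := Metric.sphere 0 1 ∩ {u | ∀ c, A *ᵥ c = 0 → u ⬝ᵥ c = 0}
  have hclosed : IsClosed {u : Fin n → ℝ | ∀ c, A *ᵥ c = 0 → u ⬝ᵥ c = 0} := by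
    simp only [Set.ofPred_forall]
    exact isClosed_iInter fun c => isClosed_iInter fun _ =>
      isClosed_eq (continuous_id.dotProduct continuous_const) continuous_const
  have hQ : IsCompact Q := (isCompact_sphere 0 1).inter_right hclosed
  have hf : ContinuousOn (fun u : Fin n → ℝ => (S *ᵥ u ⬝ᵥ u) / (A *ᵥ u ⬝ᵥ u)) Q := by
    refine (hcont S).continuousOn.div (hcont A).continuousOn fun u hu => ne_of_gt ?_
    refine hA.mulVec_dotProduct_pos_of_orthogonal_ker hu.2 ?_
    rintro rfl
    simpa using hu.1
  obtain ⟨C, hC⟩ := hQ.bddAbove_image hf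
  refine ⟨C, fun u hu hu0 => ?_⟩
  have hn : ‖u‖ ≠ 0 := norm_ne_zero_iff.2 hu0
  have hmem : ‖u‖⁻¹ • u ∈ Q := by
    refine ⟨by simp [norm_smul, hn], fun c hc => ?_⟩
    rw [smul_dotProduct, hu c hc, smul_zero]
  have := hC ⟨_, hmem, rfl⟩
  simp only [mulVec_smul, smul_dotProduct, dotProduct_smul, smul_eq_mul] at this
  rwa [mul_div_mul_left _ _ (inv_ne_zero hn), mul_div_mul_left _ _ (inv_ne_zero hn)] at this

end Auxiliary

/-- Convergence Rate Identity: for the Gauss–Seidel-type iteration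
with error propagation matrix `E = I - (D - L)⁻¹ 𝒜` on the singular semidefinite
system `𝒜 = D - L - Lᵀ ≠ 0`, with `S = L D⁻¹ Lᵀ`, `N = ker 𝒜`, `N⊥` its orthogonal
complement, the constant
`K = 1 + sup_{u ∈ N⊥, u ≠ 0} inf_{c ∈ N} ⟨S(u+c), u+c⟩ / ⟨𝒜 u, u⟩`
is well defined (the set is nonempty and bounded above) and
`sup_{u ∈ N⊥, u ≠ 0} ⟨𝒜 E u, E u⟩ / ⟨𝒜 u, u⟩ = 1 - 1/K`. -/
theorem convergence_rate_identity (n : ℕ) (hn : 0 < n)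
    (𝒜 D L : Matrix (Fin n) (Fin n) ℝ)
    (h𝒜 : 𝒜.PosSemidef) (hD : D.PosDef) (hDL : IsUnit (D - L))
    (hsplit : 𝒜 = D - L - Lᵀ) (h𝒜0 : 𝒜 ≠ 0) :
    let S := L * D⁻¹ * Lᵀ
    let E := (1 : Matrix (Fin n) (Fin n) ℝ) - (D - L)⁻¹ * 𝒜
    let N : Set (Fin n → ℝ) := {c | 𝒜.mulVec c = 0}
    let Nperp : Set (Fin n → ℝ) := {u | ∀ c ∈ N, u ⬝ᵥ c = 0}
    let ratios : Set ℝ :=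
      {r | ∃ u ∈ Nperp, u ≠ 0 ∧
        r = sInf {s | ∃ c ∈ N,
              s = (S.mulVec (u + c)) ⬝ᵥ (u + c) / ((𝒜.mulVec u) ⬝ᵥ u)}}
    ratios.Nonempty ∧ BddAbove ratios ∧
      sSup {r | ∃ u ∈ Nperp, u ≠ 0 ∧
            r = ((𝒜.mulVec (E.mulVec u)) ⬝ᵥ (E.mulVec u)) / ((𝒜.mulVec u) ⬝ᵥ u)}
        = 1 - 1 / (1 + sSup ratios) := by
  intro S E N Nperp ratios
  have hAs := h𝒜.isSymm_real
  have hDs := hD.posSemidef.isSymm_real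
  have hDdet : IsUnit D.det := (Matrix.isUnit_iff_isUnit_det _).1 hD.isUnit
  have hMdet : IsUnit (D - L).det := (Matrix.isUnit_iff_isUnit_det _).1 hDL
  set B := (D - L)⁻¹
  have hMB : (D - L) * B = 1 := Matrix.mul_nonsing_inv _ hMdet
  have hBM : B * (D - L) = 1 := Matrix.nonsing_inv_mul _ hMdet
  have hDD : D * D⁻¹ = 1 := Matrix.mul_nonsing_inv _ hDdet
  have hDD' : D⁻¹ * D = 1 := Matrix.nonsing_inv_mul _ hDdet
  have hBMt : Bᵀ * (D - L)ᵀ = 1 := by rw [← transpose_mul, hMB, transpose_one]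
  -- `R` is the symmetrized smoother, the inverse of `𝒜 + S`
  set R := Bᵀ * D * B with hRdef
  have hR : R.PosDef := by
    have hinj : Function.Injective B.mulVec := by
      intro x y hxy
      simpa [mulVec_mulVec, hMB] using congrArg ((D - L) *ᵥ ·) hxy
    simpa [conjTranspose_eq_transpose_of_trivial] using hD.conjTranspose_mul_mul_same hinj
  have hS : S.PosSemidef := by
    simpa [conjTranspose_eq_transpose_of_trivial] using
      hD.inv.posSemidef.mul_mul_conjTranspose_same L
  have hT : 𝒜 + S = (D - L) * D⁻¹ * (D - L)ᵀ := by
    rw [transpose_sub, hDs.eq, hsplit]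
    simp only [S, Matrix.sub_mul, Matrix.mul_sub, hDD, Matrix.one_mul, Matrix.mul_assoc, hDD',
      Matrix.mul_one]
    abel
  have hRT : R * (𝒜 + S) = 1 := by
    calc R * (𝒜 + S) = Bᵀ * (D * ((B * (D - L)) * D⁻¹)) * (D - L)ᵀ := by
          rw [hT, hRdef]; simp only [Matrix.mul_assoc]
      _ = 1 := by rw [hBM, Matrix.one_mul, hDD, Matrix.mul_one, hBMt]
  have hTR : (𝒜 + S) * R = 1 := mul_eq_one_comm.1 hRT
  have hEAE : Eᵀ * 𝒜 * E = 𝒜 - 𝒜 * R * 𝒜 := by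
    have hA' : 𝒜 = (D - L) + (D - L)ᵀ - D := by
      rw [hsplit, transpose_sub, hDs.eq]; abel
    have hR' : R = Bᵀ + B - Bᵀ * 𝒜 * B := by
      have : Bᵀ * 𝒜 * B = Bᵀ * ((D - L) * B) + (Bᵀ * (D - L)ᵀ) * B - Bᵀ * D * B := by
        rw [hA']; simp only [Matrix.mul_sub, Matrix.sub_mul, Matrix.mul_add, Matrix.add_mul,
          Matrix.mul_assoc]
      rw [this, hMB, hBMt, Matrix.mul_one, Matrix.one_mul, ← hRdef]
      abel
    rw [hR']
    simp only [E, transpose_sub, transpose_one, transpose_mul, hAs.eq]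
    noncomm_ring
  set a : (Fin n → ℝ) → ℝ := fun u => 𝒜 *ᵥ u ⬝ᵥ u with ha
  set q : (Fin n → ℝ) → ℝ := fun u => R *ᵥ (𝒜 *ᵥ u) ⬝ᵥ (𝒜 *ᵥ u) with hq
  have hapos : ∀ u ∈ Nperp, u ≠ 0 → 0 < a u := fun u hu hu0 =>
    h𝒜.mulVec_dotProduct_pos_of_orthogonal_ker hu hu0
  have hqpos : ∀ u, 𝒜 *ᵥ u ≠ 0 → 0 < q u := fun u hu => by
    simpa [hq, dotProduct_comm] using hR.dotProduct_mulVec_pos hu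
  have hA0 : ∀ u ∈ Nperp, u ≠ 0 → 𝒜 *ᵥ u ≠ 0 := fun u hu hu0 h => by
    have := hapos u hu hu0
    simp [ha, h] at this
  have hrange : ∀ v, 𝒜 *ᵥ v ∈ Nperp := fun v c hc => by
    rw [hAs.mulVec_dotProduct, show 𝒜 *ᵥ c = 0 from hc, dotProduct_zero]
  have hrate : ∀ u, 𝒜 *ᵥ (E *ᵥ u) ⬝ᵥ (E *ᵥ u) = a u - q u := fun u => by
    have h1 : 𝒜 *ᵥ (E *ᵥ u) ⬝ᵥ (E *ᵥ u) = (Eᵀ * 𝒜 * E) *ᵥ u ⬝ᵥ u := by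
      rw [← mulVec_mulVec, ← mulVec_mulVec, mulVec_transpose, ← dotProduct_mulVec]
    rw [h1, hEAE, sub_mulVec, sub_dotProduct, ← mulVec_mulVec, ← mulVec_mulVec,
      hAs.mulVec_dotProduct (R *ᵥ 𝒜 *ᵥ u)]
  have hshift : ∀ u, ∀ c ∈ N, (𝒜 + S) *ᵥ (u + c) ⬝ᵥ (u + c)
      = a u + S *ᵥ (u + c) ⬝ᵥ (u + c) := fun u c hc => by
    have hc' : 𝒜 *ᵥ c = 0 := hc
    rw [add_mulVec, add_dotProduct, mulVec_add 𝒜, hc', add_zero, dotProduct_add,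
      hAs.mulVec_dotProduct u c, hc', dotProduct_zero, add_zero]
  have hbelow : ∀ u ∈ Nperp, u ≠ 0 → ∀ s ∈ {s | ∃ c ∈ N,
      s = (S.mulVec (u + c)) ⬝ᵥ (u + c) / ((𝒜.mulVec u) ⬝ᵥ u)}, 0 ≤ s := by
    rintro u hu hu0 _ ⟨c, -, rfl⟩
    exact div_nonneg (hS.zero_le_mulVec_dotProduct _) (hapos u hu hu0).le
  have h0N : (0 : Fin n → ℝ) ∈ N := mulVec_zero 𝒜
  obtain ⟨v, hv⟩ : ∃ v, 𝒜 *ᵥ v ≠ 0 := by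
    by_contra! h
    exact h𝒜0 (Matrix.ext_of_mulVec_single fun i => by rw [h, zero_mulVec])
  have hne : ratios.Nonempty := ⟨_, 𝒜 *ᵥ v, hrange v, hv, rfl⟩
  have hbdd : BddAbove ratios := by
    obtain ⟨C, hC⟩ := h𝒜.exists_div_le_of_orthogonal_ker S
    refine ⟨C, ?_⟩
    rintro _ ⟨u, hu, hu0, rfl⟩
    exact (csInf_le ⟨0, hbelow u hu hu0⟩ ⟨0, h0N, by rw [add_zero]⟩).trans (hC u hu hu0)
  refine ⟨hne, hbdd, sSup_eq_one_sub_inv_one_add_sSup hne hbdd ?_ ?_ ?_⟩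
  · rintro _ ⟨u, hu, hu0, rfl⟩
    exact le_csInf ⟨_, 0, h0N, rfl⟩ (hbelow u hu hu0)
  · rintro _ ⟨u, hu, hu0, rfl⟩
    have hau := hapos u hu hu0
    have hqu := hqpos u (hA0 u hu hu0)
    rw [hrate]
    change (a u - q u) / a u < 1 ∧ _
    rw [sub_div, div_self hau.ne']
    refine ⟨by have := div_pos hqu hau; linarith, _, ⟨u, hu, hu0, rfl⟩, ?_⟩
    have key : a u / q u - 1 ≤ sInf {s | ∃ c ∈ N,
        s = (S.mulVec (u + c)) ⬝ᵥ (u + c) / ((𝒜.mulVec u) ⬝ᵥ u)} := by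
      refine le_csInf ⟨_, 0, h0N, rfl⟩ ?_
      rintro _ ⟨c, hc, rfl⟩
      have hcs := hR.posSemidef.sq_mulVec_dotProduct_le ((𝒜 + S) *ᵥ (u + c)) (𝒜 *ᵥ u)
      rw [mulVec_mulVec, hRT, one_mulVec, dotProduct_comm (u + c) ((𝒜 + S) *ᵥ (u + c)),
        hshift u c hc, dotProduct_comm (u + c), dotProduct_add, hAs.mulVec_dotProduct u c,
        show 𝒜 *ᵥ c = 0 from hc, dotProduct_zero, add_zero] at hcs
      change a u ^ 2 ≤ (a u + _) * q u at hcs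
      change _ ≤ _ / a u
      rw [sub_le_iff_le_add, div_le_iff₀ hqu, div_add_one hau.ne', div_mul_eq_mul_div,
        le_div_iff₀ hau]
      linarith
    have h1 : 1 / (1 + sInf {s | ∃ c ∈ N,
        s = (S.mulVec (u + c)) ⬝ᵥ (u + c) / ((𝒜.mulVec u) ⬝ᵥ u)}) ≤ 1 / (a u / q u) :=
      one_div_le_one_div_of_le (div_pos hau hqu) (by linarith)
    rw [one_div_div] at h1
    linarith
  · rintro _ ⟨u, hu, hu0, rfl⟩
    have hau := hapos u hu hu0
    obtain ⟨w₀, hw₀⟩ := hR.exists_conj_mulVec_eq hAs u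
    obtain ⟨v₀, hv₀⟩ := Matrix.PosDef.one.exists_conj_mulVec_eq hAs w₀
    rw [one_mulVec] at hv₀
    set w := 𝒜 *ᵥ v₀ with hw
    rw [← hv₀] at hw₀
    have hwN : w ∈ Nperp := hrange v₀
    have hAw : 𝒜 *ᵥ w ≠ 0 := fun h => hA0 u hu hu0 (by rw [← hw₀, h, mulVec_zero, mulVec_zero])
    have hw0 : w ≠ 0 := fun h => hAw (by rw [h, mulVec_zero])
    have haw := hapos w hwN hw0
    have hqw := hqpos w hAw
    refine ⟨_, ⟨w, hwN, hw0, rfl⟩, ?_⟩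
    rw [hrate]
    change _ ≤ 1 / (1 - (a w - q w) / a w)
    rw [sub_div, div_self haw.ne', sub_sub_cancel, one_div_div]
    set c := R *ᵥ (𝒜 *ᵥ w) - u with hcdef
    have hc : c ∈ N := by
      change 𝒜 *ᵥ c = 0
      rw [hcdef, mulVec_sub, hw₀, sub_self]
    have huc : u + c = R *ᵥ (𝒜 *ᵥ w) := by rw [hcdef]; abel
    have hqeq : q w = a u + S *ᵥ (u + c) ⬝ᵥ (u + c) := by
      rw [← hshift u c hc, huc, mulVec_mulVec, hTR, one_mulVec, dotProduct_comm]
    have hqeq' : q w = 𝒜 *ᵥ w ⬝ᵥ u := by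
      change R *ᵥ (𝒜 *ᵥ w) ⬝ᵥ 𝒜 *ᵥ w = _
      rw [← hAs.mulVec_dotProduct, hw₀, hAs.mulVec_dotProduct, dotProduct_comm]
    have hcs := h𝒜.sq_mulVec_dotProduct_le w u
    rw [← hqeq'] at hcs
    change q w ^ 2 ≤ a w * a u at hcs
    have hle := csInf_le ⟨0, hbelow u hu hu0⟩ ⟨c, hc, rfl⟩
    have h2 : S *ᵥ (u + c) ⬝ᵥ (u + c) / (𝒜 *ᵥ u ⬝ᵥ u) = q w / a u - 1 := by
      rw [hqeq, add_div, div_self hau.ne', add_sub_cancel_left]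
    have h3 : q w / a u ≤ a w / q w := by
      rw [div_le_div_iff₀ hau hqw]
      linarith
    linarith
end

section
/- Assume 𝒜 ≠ 0. Then (𝒜 + S is invertible and) the following two expressions for the convergence constant agree: sup_{u ∈ N⊥, u ≠ 0} ⟨𝒜 u, u⟩ / ⟨𝒜 (𝒜 + S)⁻¹ 𝒜 u, u⟩ = sup_{w ∈ N⊥, w ≠ 0} inf_{c ∈ N} ⟨(𝒜 + S)(w + c), w + c⟩ / ⟨𝒜 w, w⟩. -/
open Matrix

namespace Matrix

variable {ι : Type*} [Fintype ι]

theorem IsSymm.mulVec_dotProduct_comm {P : Matrix ι ι ℝ} (hP : P.IsSymm) (x y : ι → ℝ) :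
    (P *ᵥ x) ⬝ᵥ y = x ⬝ᵥ (P *ᵥ y) := by
  rw [dotProduct_mulVec, ← mulVec_transpose, hP.eq]

/-- The Cauchy–Schwarz inequality for the form of a positive semidefinite matrix. -/
theorem PosSemidef.sq_mulVec_dotProduct_le_s7 {P : Matrix ι ι ℝ} (hP : P.PosSemidef)
    (x y : ι → ℝ) :
    ((P *ᵥ x) ⬝ᵥ y) ^ 2 ≤ ((P *ᵥ x) ⬝ᵥ x) * ((P *ᵥ y) ⬝ᵥ y) := by
  have hsymm : P.IsSymm := isHermitian_iff_isSymm.mp hP.isHermitian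
  have hyx : (P *ᵥ y) ⬝ᵥ x = (P *ᵥ x) ⬝ᵥ y := by
    rw [hsymm.mulVec_dotProduct_comm, dotProduct_comm]
  have h : discrim ((P *ᵥ y) ⬝ᵥ y) (2 * ((P *ᵥ x) ⬝ᵥ y)) ((P *ᵥ x) ⬝ᵥ x) ≤ 0 := by
    refine discrim_le_zero fun t => ?_
    have := hP.dotProduct_mulVec_nonneg (x + t • y)
    rw [star_trivial, dotProduct_comm] at this
    simp only [mulVec_add, mulVec_smul, add_dotProduct, dotProduct_add, smul_dotProduct,
      dotProduct_smul, smul_eq_mul, hyx] at this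
    linarith
  rw [discrim] at h
  linarith

theorem PosDef.mulVec_dotProduct_pos {P : Matrix ι ι ℝ} (hP : P.PosDef) {x : ι → ℝ}
    (hx : x ≠ 0) : 0 < (P *ᵥ x) ⬝ᵥ x := by
  simpa [dotProduct_comm] using hP.dotProduct_mulVec_pos hx

theorem PosSemidef.mulVec_dotProduct_nonneg {P : Matrix ι ι ℝ} (hP : P.PosSemidef)
    (x : ι → ℝ) : 0 ≤ (P *ᵥ x) ⬝ᵥ x := by
  simpa [dotProduct_comm] using hP.dotProduct_mulVec_nonneg x

theorem PosSemidef.mulVec_dotProduct_pos {P : Matrix ι ι ℝ} (hP : P.PosSemidef) {x : ι → ℝ}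
    (hx : P *ᵥ x ≠ 0) : 0 < (P *ᵥ x) ⬝ᵥ x := by
  refine (hP.mulVec_dotProduct_nonneg x).lt_of_ne' fun h => hx ?_
  have := hP.sq_mulVec_dotProduct_le_s7 x (P *ᵥ x)
  rw [h, zero_mul] at this
  exact dotProduct_self_eq_zero.mp (pow_eq_zero_iff two_ne_zero |>.mp
    (le_antisymm this (sq_nonneg _)))

/-- If `A` is symmetric and `P` positive definite, then the range of `A` is that of
`A * P * A * A`. -/
theorem PosDef.exists_mulVec_eq_mulVec {A P : Matrix ι ι ℝ} (hA : A.IsSymm) (hP : P.PosDef)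
    (w : ι → ℝ) : ∃ z, A *ᵥ (P *ᵥ (A *ᵥ (A *ᵥ z))) = A *ᵥ w := by
  have hle : LinearMap.range (A.mulVecLin ∘ₗ P.mulVecLin ∘ₗ A.mulVecLin ∘ₗ A.mulVecLin) ≤
      LinearMap.range A.mulVecLin := LinearMap.range_comp_le_range _ _
  have hker : LinearMap.ker (A.mulVecLin ∘ₗ P.mulVecLin ∘ₗ A.mulVecLin ∘ₗ A.mulVecLin) =
      LinearMap.ker A.mulVecLin := by
    ext z
    simp only [LinearMap.mem_ker, LinearMap.comp_apply, mulVecLin_apply]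
    refine ⟨fun h => ?_, fun h => by simp [h]⟩
    have hAA : A *ᵥ (A *ᵥ z) = 0 := by
      by_contra hne
      refine (hP.mulVec_dotProduct_pos hne).ne' ?_
      rw [← hA.mulVec_dotProduct_comm, h, zero_dotProduct]
    rw [← dotProduct_self_eq_zero, hA.mulVec_dotProduct_comm, hAA, dotProduct_zero]
  have hrank := LinearMap.finrank_range_add_finrank_ker
    (A.mulVecLin ∘ₗ P.mulVecLin ∘ₗ A.mulVecLin ∘ₗ A.mulVecLin)
  have hrankA := LinearMap.finrank_range_add_finrank_ker A.mulVecLin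
  rw [hker] at hrank
  have heq := Submodule.eq_of_le_of_finrank_eq hle (by omega)
  have hw : A *ᵥ w ∈ LinearMap.range A.mulVecLin := ⟨w, rfl⟩
  rw [← heq] at hw
  exact hw

theorem posDef_splitting_product [DecidableEq ι] {D L : Matrix ι ι ℝ} (hD : D.PosDef)
    (hDL : IsUnit (D - L)) : (D - L - Lᵀ + L * D⁻¹ * Lᵀ).PosDef := by
  have hsymm : Dᵀ = D := isHermitian_iff_isSymm.mp hD.isHermitian
  have hdet : IsUnit D.det := (isUnit_iff_isUnit_det D).mp hD.isUnit
  have h : D - L - Lᵀ + L * D⁻¹ * Lᵀ = (D - L) * D⁻¹ * (D - L)ᴴ := by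
    rw [conjTranspose_eq_transpose_of_trivial, transpose_sub, hsymm]
    simp only [sub_mul, mul_sub, mul_nonsing_inv _ hdet, one_mul,
      nonsing_inv_mul_cancel_right _ _ hdet]
    abel
  rw [h]
  exact hD.inv.mul_mul_conjTranspose_same (vecMul_injective_of_isUnit hDL)

end Matrix

/-- `𝒜 + S` is invertible, and the two expressions for the
convergence constant agree:
`sup_{u ∈ N⊥, u ≠ 0} ⟨𝒜 u, u⟩ / ⟨𝒜 (𝒜+S)⁻¹ 𝒜 u, u⟩
  = sup_{w ∈ N⊥, w ≠ 0} inf_{c ∈ N} ⟨(𝒜+S)(w+c), w+c⟩ / ⟨𝒜 w, w⟩`. -/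
theorem convergence_constant_two_forms (n : ℕ) (hn : 0 < n)
    (𝒜 D L : Matrix (Fin n) (Fin n) ℝ)
    (h𝒜 : 𝒜.PosSemidef) (hD : D.PosDef) (hDL : IsUnit (D - L))
    (hsplit : 𝒜 = D - L - Lᵀ) (h𝒜0 : 𝒜 ≠ 0) :
    let S := L * D⁻¹ * Lᵀ
    let N : Set (Fin n → ℝ) := {c | 𝒜.mulVec c = 0}
    let Nperp : Set (Fin n → ℝ) := {u | ∀ c ∈ N, u ⬝ᵥ c = 0}
    IsUnit (𝒜 + S) ∧
      sSup {r | ∃ u ∈ Nperp, u ≠ 0 ∧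
            r = ((𝒜.mulVec u) ⬝ᵥ u)
                  / (((𝒜 * (𝒜 + S)⁻¹ * 𝒜).mulVec u) ⬝ᵥ u)}
        = sSup {r | ∃ w ∈ Nperp, w ≠ 0 ∧
            r = sInf {s | ∃ c ∈ N,
                  s = (((𝒜 + S).mulVec (w + c)) ⬝ᵥ (w + c)) / ((𝒜.mulVec w) ⬝ᵥ w)}} := by
  intro S N Nperp
  have hM : (𝒜 + S).PosDef := by
    have := posDef_splitting_product hD hDL
    rwa [← hsplit] at this
  have hsymm : 𝒜.IsSymm := isHermitian_iff_isSymm.mp h𝒜.isHermitian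
  have hMinv : ∀ x, (𝒜 + S) *ᵥ ((𝒜 + S)⁻¹ *ᵥ x) = x := fun x => by
    rw [mulVec_mulVec, mul_nonsing_inv _ ((isUnit_iff_isUnit_det _).mp hM.isUnit), one_mulVec]
  have hform : ∀ u, ((𝒜 * (𝒜 + S)⁻¹ * 𝒜) *ᵥ u) ⬝ᵥ u =
      ((𝒜 + S)⁻¹ *ᵥ (𝒜 *ᵥ u)) ⬝ᵥ (𝒜 *ᵥ u) := fun u => by
    rw [← mulVec_mulVec, ← mulVec_mulVec, hsymm.mulVec_dotProduct_comm]
  have hne : ∀ u ∈ Nperp, u ≠ 0 → 𝒜 *ᵥ u ≠ 0 := fun u hu hu0 h =>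
    hu0 (dotProduct_self_eq_zero.mp (hu u h))
  refine ⟨hM.isUnit, csSup_eq_csSup_of_forall_exists_le ?_ ?_⟩
  · rintro _ ⟨v, hv, hv0, rfl⟩
    refine ⟨_, ⟨v, hv, hv0, rfl⟩, le_csInf ⟨_, 0, mulVec_zero _, rfl⟩ ?_⟩
    rintro _ ⟨c, hc, rfl⟩
    have hpos := h𝒜.mulVec_dotProduct_pos (hne v hv hv0)
    have hpos' := hM.inv.mulVec_dotProduct_pos (hne v hv hv0)
    have hcs := hM.inv.posSemidef.sq_mulVec_dotProduct_le_s7 (𝒜 *ᵥ v) ((𝒜 + S) *ᵥ (v + c))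
    have hinv : (𝒜 + S)⁻¹ *ᵥ ((𝒜 + S) *ᵥ (v + c)) = v + c := by
      rw [mulVec_mulVec, nonsing_inv_mul _ ((isUnit_iff_isUnit_det _).mp hM.isUnit), one_mulVec]
    have hc' : 𝒜 *ᵥ c = 0 := hc
    have hcross : ((𝒜 + S)⁻¹ *ᵥ (𝒜 *ᵥ v)) ⬝ᵥ ((𝒜 + S) *ᵥ (v + c)) = (𝒜 *ᵥ v) ⬝ᵥ v := by
      rw [(isHermitian_iff_isSymm.mp hM.inv.isHermitian).mulVec_dotProduct_comm, hinv,
        dotProduct_add, hsymm.mulVec_dotProduct_comm v c, hc', dotProduct_zero, add_zero]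
    rw [hcross, hinv, dotProduct_comm (v + c)] at hcs
    rw [hform, div_le_div_iff₀ hpos' hpos]
    linarith
  · rintro _ ⟨w, hw, hw0, rfl⟩
    obtain ⟨z, hz⟩ := hM.inv.exists_mulVec_eq_mulVec hsymm w
    have hu : 𝒜 *ᵥ z ∈ Nperp := fun c (hc : 𝒜 *ᵥ c = 0) => by
      rw [hsymm.mulVec_dotProduct_comm, hc, dotProduct_zero]
    generalize 𝒜 *ᵥ z = u at hz hu
    have hAw := hne w hw hw0
    have hAu : 𝒜 *ᵥ u ≠ 0 := fun h => hAw (by rw [← hz, h, mulVec_zero, mulVec_zero])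
    have hu0 : u ≠ 0 := fun h => hAu (by rw [h, mulVec_zero])
    have hpos := h𝒜.mulVec_dotProduct_pos hAw
    have hpos' := hM.inv.mulVec_dotProduct_pos hAu
    refine ⟨_, ⟨u, hu, hu0, rfl⟩, le_trans (csInf_le ⟨0, ?_⟩
      (Exists.intro ((𝒜 + S)⁻¹ *ᵥ (𝒜 *ᵥ u) - w) ⟨?_, rfl⟩)) ?_⟩
    · rintro _ ⟨c, -, rfl⟩
      exact div_nonneg (hM.posSemidef.mulVec_dotProduct_nonneg _) hpos.le
    · change 𝒜 *ᵥ _ = 0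
      rw [mulVec_sub, hz, sub_self]
    · have hcs := h𝒜.sq_mulVec_dotProduct_le_s7 u ((𝒜 + S)⁻¹ *ᵥ (𝒜 *ᵥ u))
      have hww : (𝒜 *ᵥ ((𝒜 + S)⁻¹ *ᵥ (𝒜 *ᵥ u))) ⬝ᵥ ((𝒜 + S)⁻¹ *ᵥ (𝒜 *ᵥ u)) =
          (𝒜 *ᵥ w) ⬝ᵥ w := by
        rw [hz, hsymm.mulVec_dotProduct_comm, hz, dotProduct_comm]
      rw [hww, dotProduct_comm] at hcs
      rw [add_sub_cancel, hMinv, hform, dotProduct_comm (𝒜 *ᵥ u) (_ *ᵥ _),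
        div_le_div_iff₀ hpos hpos']
      linarith
end

section
/- (Equivalence of the two-level method with block Gauss–Seidel on the augmented system.) The matrix 𝒟 − 𝓛 is invertible, and for every f ∈ ℝ^{n_h} and every (v̄, v̂) ∈ ℝ^{n_H} × ℝ^{n_h} the following holds: if (v̄′, v̂′) := (v̄, v̂) + (𝒟 − 𝓛)⁻¹ (f̃ − 𝒜 (v̄, v̂)) is one step of the block Gauss–Seidel iteration for the augmented system, then P v̄′ + v̂′ = ũ + (D − L)⁻¹ (f − A ũ), where u := P v̄ + v̂ and ũ := u + P A_H⁻¹ Pᵀ (f − A u). (That is, one augmented Gauss–Seidel step reproduces one step of the two-level method: coarse-grid correction by A_H followed by Gauss–Seidel postsmoothing on A.) -/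
open Matrix

/-- The two-level method equals block Gauss–Seidel on the augmented
system: `𝒟 - 𝓛` is invertible, and one block Gauss–Seidel step
`(v̄', v̂') = (v̄, v̂) + (𝒟 - 𝓛)⁻¹ (f̃ - 𝒜 (v̄, v̂))` satisfies
`P v̄' + v̂' = ũ + (D - L)⁻¹ (f - A ũ)` where `u = P v̄ + v̂` and
`ũ = u + P A_H⁻¹ Pᵀ (f - A u)`. -/
theorem two_level_eq_block_gauss_seidel (nH nh : ℕ) (hnH : 0 < nH) (hnh : 0 < nh)
    (A : Matrix (Fin nh) (Fin nh) ℝ) (hAsymm : A.IsSymm)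
    (P : Matrix (Fin nh) (Fin nH) ℝ)
    (D L : Matrix (Fin nh) (Fin nh) ℝ)
    (hDdef : D = Matrix.diagonal fun i => A i i)
    (hLdef : L = Matrix.of fun i j => if j < i then -A i j else 0)
    (hAH : IsUnit (Pᵀ * A * P)) (hD : IsUnit D) (hDL : IsUnit (D - L)) :
    let AH := Pᵀ * A * P
    let 𝒜 := Matrix.fromBlocks AH (Pᵀ * A) (A * P) A
    let 𝒟 := Matrix.fromBlocks AH 0 0 D
    let 𝓛 := Matrix.fromBlocks 0 0 (-(A * P)) L
    IsUnit (𝒟 - 𝓛) ∧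
      ∀ (f : Fin nh → ℝ) (vbar : Fin nH → ℝ) (vhat : Fin nh → ℝ),
        let ftil := Sum.elim (Pᵀ.mulVec f) f
        let v' := Sum.elim vbar vhat
          + (𝒟 - 𝓛)⁻¹.mulVec (ftil - 𝒜.mulVec (Sum.elim vbar vhat))
        let u := P.mulVec vbar + vhat
        let util := u + P.mulVec ((AH⁻¹).mulVec (Pᵀ.mulVec (f - A.mulVec u)))
        P.mulVec (fun i => v' (Sum.inl i)) + (fun i => v' (Sum.inr i))
          = util + (D - L)⁻¹.mulVec (f - A.mulVec util) := by
  intro AH 𝒜 𝒟 𝓛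
  have hsub : 𝒟 - 𝓛 = Matrix.fromBlocks AH 0 (A * P) (D - L) := by
    simp [𝒟, 𝓛, sub_eq_add_neg, Matrix.fromBlocks_neg, Matrix.fromBlocks_add]
  refine ⟨hsub ▸ Matrix.isUnit_fromBlocks_zero₁₂.2 ⟨hAH, hDL⟩, ?_⟩
  intro f vbar vhat ftil v' u util
  have hres : ftil - 𝒜.mulVec (Sum.elim vbar vhat)
      = Sum.elim (Pᵀ.mulVec (f - A.mulVec u)) (f - A.mulVec u) := by
    ext (i | i) <;>
      simp [ftil, 𝒜, AH, u, Matrix.fromBlocks_mulVec, Matrix.mulVec_add,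
        Matrix.mulVec_sub, Matrix.mul_assoc]
  set r := f - A.mulVec u with hr
  set w := AH⁻¹.mulVec (Pᵀ.mulVec r) with hw
  have hstep : v' = Sum.elim (vbar + w)
      (vhat + (D - L)⁻¹.mulVec (r - A.mulVec (P.mulVec w))) := by
    simp only [v', hres]
    rw [hsub, Matrix.inv_fromBlocks_zero₁₂_of_isUnit_iff AH _ _ (iff_of_true hAH hDL)]
    ext (i | i) <;>
      simp [Matrix.fromBlocks_mulVec, hw, Matrix.mulVec_sub, Matrix.neg_mulVec,
        Matrix.mul_assoc, neg_add_eq_sub]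
  have hutil : f - A.mulVec util = r - A.mulVec (P.mulVec w) := by
    simp only [util, Matrix.mulVec_add, hr]
    abel
  rw [hutil, hstep]
  change P.mulVec (vbar + w) + (vhat + (D - L)⁻¹.mulVec (r - A.mulVec (P.mulVec w)))
    = P.mulVec vbar + vhat + P.mulVec w + (D - L)⁻¹.mulVec (r - A.mulVec (P.mulVec w))
  rw [Matrix.mulVec_add]
  abel
end

section
/- (Projection form of the symmetrized quadratic form; the second expression for K in the Convergence Rate Identity.) The block matrix 𝒟 is invertible, and for every w̄ ∈ ℝ^{n_H} and ŵ ∈ ℝ^{n_h}, with 𝒮 := 𝓛 𝒟⁻¹ 𝓛ᵀ, one has ⟨(𝒜 + 𝒮)(w̄, ŵ), (w̄, ŵ)⟩ = ⟨A_H q, q⟩ + Σ_{i=1}^{n_h} ( Σ_{j ≥ i} A_{ij} ŵ_j )² / A_{ii}, where q := w̄ + A_H⁻¹ Pᵀ A ŵ. (The first term is the squared 𝒜-seminorm of the image of (w̄, ŵ) under the 𝒜-projection onto the coarse block, and the i-th summand is the squared 𝒜-seminorm of the image under the 𝒜-projection onto the i-th fine coordinate of the tail Σ_{j ≥ i} ŵ_j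 e_j.) -/
open Matrix

theorem Matrix.isUnit_and_inv_fromBlocks_zero_zero {m n : Type*} [Fintype m] [Fintype n]
    [DecidableEq m] [DecidableEq n] {A : Matrix m m ℝ} {D : Matrix n n ℝ}
    (hA : IsUnit A) (hD : IsUnit D) :
    IsUnit (fromBlocks A 0 0 D) ∧ (fromBlocks A 0 0 D)⁻¹ = fromBlocks A⁻¹ 0 0 D⁻¹ := by
  have h : fromBlocks A 0 0 D * fromBlocks A⁻¹ 0 0 D⁻¹ = 1 := by
    rw [isUnit_iff_isUnit_det] at hA hD
    simp [fromBlocks_multiply, mul_nonsing_inv _ hA, mul_nonsing_inv _ hD]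
  exact ⟨IsUnit.of_mul_eq_one _ h, inv_eq_right_inv h⟩

/-- Completing the square in a quadratic form with a positive definite leading block. -/
theorem Matrix.mulVec_add_inv_mulVec_dotProduct {n : Type*} [Fintype n] [DecidableEq n]
    {M : Matrix n n ℝ} (hM : IsUnit M) (hsymm : Mᵀ = M) (w g : n → ℝ) :
    (M *ᵥ (w + M⁻¹ *ᵥ g)) ⬝ᵥ (w + M⁻¹ *ᵥ g)
      = (M *ᵥ w) ⬝ᵥ w + 2 * (g ⬝ᵥ w) + (M⁻¹ *ᵥ g) ⬝ᵥ g := by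
  rw [isUnit_iff_isUnit_det] at hM
  have hg : M *ᵥ (M⁻¹ *ᵥ g) = g := by
    rw [mulVec_mulVec, mul_nonsing_inv _ hM, one_mulVec]
  have hw : (M *ᵥ w) ⬝ᵥ (M⁻¹ *ᵥ g) = g ⬝ᵥ w := by
    rw [dotProduct_comm, dotProduct_mulVec, ← mulVec_transpose, hsymm, hg]
  rw [mulVec_add, hg, add_dotProduct, dotProduct_add, dotProduct_add, hw,
    dotProduct_comm g (M⁻¹ *ᵥ g)]
  ring

/-- If `A = D - L - Lᵀ` with `D` symmetric and invertible, then
`A + L D⁻¹ Lᵀ = (D - L) D⁻¹ (D - L)ᵀ`. -/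
theorem Matrix.add_mul_inv_mul_transpose_eq {n : Type*} [Fintype n] [DecidableEq n]
    {A D L : Matrix n n ℝ} (hD : IsUnit D) (hsymm : Dᵀ = D) (hA : A = D - L - Lᵀ) :
    A + L * D⁻¹ * Lᵀ = (D - L) * D⁻¹ * (D - L)ᵀ := by
  rw [isUnit_iff_isUnit_det] at hD
  rw [transpose_sub, hsymm, sub_mul, mul_nonsing_inv _ hD, sub_mul, one_mul, mul_sub,
    mul_assoc L D⁻¹ D, nonsing_inv_mul _ hD, mul_one, hA]
  abel

open Matrix

/-- Projection form of the symmetrized quadratic form: `𝒟` is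
invertible and, with `𝒮 = 𝓛 𝒟⁻¹ 𝓛ᵀ`,
`⟨(𝒜 + 𝒮)(w̄, ŵ), (w̄, ŵ)⟩ = ⟨A_H q, q⟩ + Σ_i (Σ_{j ≥ i} A_{ij} ŵ_j)² / A_{ii}`
where `q = w̄ + A_H⁻¹ Pᵀ A ŵ`. -/
theorem symmetrized_form_projection (nH nh : ℕ) (hnH : 0 < nH) (hnh : 0 < nh)
    (A : Matrix (Fin nh) (Fin nh) ℝ) (hA : A.PosDef)
    (P : Matrix (Fin nh) (Fin nH) ℝ)
    (hP : ∀ x : Fin nH → ℝ, P.mulVec x = 0 → x = 0)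
    (D L : Matrix (Fin nh) (Fin nh) ℝ)
    (hDdef : D = Matrix.diagonal fun i => A i i)
    (hLdef : L = Matrix.of fun i j => if j < i then -A i j else 0) :
    let AH := Pᵀ * A * P
    let 𝒜 := Matrix.fromBlocks AH (Pᵀ * A) (A * P) A
    let 𝒟 := Matrix.fromBlocks AH 0 0 D
    let 𝓛 := Matrix.fromBlocks 0 0 (-(A * P)) L
    let 𝒮 := 𝓛 * 𝒟⁻¹ * 𝓛ᵀ
    IsUnit 𝒟 ∧
      ∀ (wbar : Fin nH → ℝ) (what : Fin nh → ℝ),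
        let q := wbar + (AH⁻¹).mulVec (Pᵀ.mulVec (A.mulVec what))
        ((𝒜 + 𝒮).mulVec (Sum.elim wbar what)) ⬝ᵥ (Sum.elim wbar what)
          = (AH.mulVec q) ⬝ᵥ q
            + ∑ i : Fin nh,
                (∑ j ∈ Finset.univ.filter (fun j => i ≤ j), A i j * what j) ^ 2 / A i i := by
  intro AH 𝒜 𝒟 𝓛 𝒮
  have hAt : Aᵀ = A := by simpa using hA.isHermitian.eq
  have hAH : AH.PosDef := by
    have hinj : Function.Injective P.mulVec := by
      intro x y hxy
      exact sub_eq_zero.mp (hP _ (by rw [mulVec_sub, sub_eq_zero]; exact hxy))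
    simpa using hA.conjTranspose_mul_mul_same hinj
  have hAHt : AHᵀ = AH := by simpa using hAH.isHermitian.eq
  have hdiag : ∀ i, A i i ≠ 0 := fun i => hA.diag_pos.ne'
  have hDunit : IsUnit D := by
    rw [hDdef, isUnit_diagonal, Pi.isUnit_iff]
    exact fun i => (hdiag i).isUnit
  have hDinv : D⁻¹ = diagonal fun i => (A i i)⁻¹ := by
    apply inv_eq_right_inv
    rw [hDdef, diagonal_mul_diagonal, ← diagonal_one]
    congr 1
    ext i
    exact mul_inv_cancel₀ (hdiag i)
  have hDt : Dᵀ = D := by rw [hDdef, diagonal_transpose]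
  have hsplit : A = D - L - Lᵀ := by
    ext i j
    have hij : A j i = A i j := congrFun (congrFun hAt i) j
    rcases lt_trichotomy i j with h | rfl | h
    · simp [hDdef, hLdef, h, h.ne, h.not_gt, hij]
    · simp [hDdef, hLdef]
    · simp [hDdef, hLdef, h, h.ne', h.not_gt]
  obtain ⟨h𝒟, h𝒟inv⟩ := isUnit_and_inv_fromBlocks_zero_zero hAH.isUnit hDunit
  refine ⟨h𝒟, fun wbar what => ?_⟩
  intro q
  have htail : ∀ i, ((D - L)ᵀ *ᵥ what) i
      = ∑ j ∈ Finset.univ.filter (fun j => i ≤ j), A i j * what j := by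
    intro i
    rw [Finset.sum_filter, mulVec, dotProduct]
    refine Finset.sum_congr rfl fun j _ => ?_
    have hij : A j i = A i j := congrFun (congrFun hAt i) j
    rcases lt_trichotomy i j with h | rfl | h
    · simp [hDdef, hLdef, h, h.ne', h.le, hij]
    · simp [hDdef, hLdef]
    · simp [hDdef, hLdef, h.ne, h.not_gt, h.not_ge]
  have hfine : ((A + L * D⁻¹ * Lᵀ) *ᵥ what) ⬝ᵥ what
      = ∑ i : Fin nh,
          (∑ j ∈ Finset.univ.filter (fun j => i ≤ j), A i j * what j) ^ 2 / A i i := by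
    rw [add_mul_inv_mul_transpose_eq hDunit hDt hsplit, ← mulVec_mulVec, ← mulVec_mulVec,
      dotProduct_comm, dotProduct_mulVec, ← mulVec_transpose, hDinv, dotProduct]
    refine Finset.sum_congr rfl fun i _ => ?_
    rw [mulVec_diagonal, htail]
    ring
  have hsum : 𝒜 + 𝒮 = fromBlocks AH (Pᵀ * A) (A * P)
      (A + L * D⁻¹ * Lᵀ + A * P * AH⁻¹ * (Pᵀ * A)) := by
    simp only [𝒜, 𝒮, 𝓛, 𝒟]
    rw [h𝒟inv, fromBlocks_transpose, fromBlocks_multiply, fromBlocks_multiply, fromBlocks_add]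
    simp [hAt, AH]
    abel
  have hAP : ∀ x y, ((A * P) *ᵥ x) ⬝ᵥ y = (Pᵀ *ᵥ (A *ᵥ y)) ⬝ᵥ x := by
    intro x y
    rw [dotProduct_comm, dotProduct_mulVec, ← mulVec_transpose, transpose_mul, hAt,
      ← mulVec_mulVec]
  rw [mulVec_add_inv_mulVec_dotProduct hAH.isUnit hAHt, ← hfine, hsum, fromBlocks_mulVec,
    sumElim_dotProduct_sumElim]
  simp only [Sum.elim_comp_inl, Sum.elim_comp_inr]
  rw [add_mulVec (A + L * D⁻¹ * Lᵀ), Matrix.mul_assoc (A * P), ← mulVec_mulVec what (A * P),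
    ← mulVec_mulVec what AH⁻¹, ← mulVec_mulVec what Pᵀ]
  simp only [add_dotProduct, hAP]
  rw [dotProduct_comm (Pᵀ *ᵥ A *ᵥ what) (AH⁻¹ *ᵥ _)]
  ring
end
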